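/- The maximum cardinality of a 4-progression-free subset of F_5^2 is exactly 11: there exists a subset of F_5^2 with 11 elements containing no 4 points in arithmetic progression, and every 4-progression-free subset of F_5^2 has at most 11 elements. -/

import Mathlib

/-- A subset `S` of `F_p^n` is `k`-progression-free if there are no `a, d` with `d ≠ 0`
such that `a + i • d ∈ S` for all `i ∈ {0, …, k-1}`. -/
def ProgFree (p n k : ℕ) (S : Finset (Fin n → ZMod p)) : Prop :=
  ¬ ∃ a d : Fin n → ZMod p, d ≠ 0 ∧ ∀ i : ℕ, i < k → a + (i : ZMod p) • d ∈ S

/-- Six linear functionals, one for each parallel class of lines. -/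
def uA : Fin 6 → ZMod 5 := ![1, 1, 1, 1, 1, 0]
def uB : Fin 6 → ZMod 5 := ![0, 1, 2, 3, 4, 1]

def fn (d : Fin 6) (x : Fin 2 → ZMod 5) : ZMod 5 := uA d * x 0 + uB d * x 1

theorem fn_add (d : Fin 6) (x y : Fin 2 → ZMod 5) : fn d (x + y) = fn d x + fn d y := by
  simp only [fn, Pi.add_apply]; ring

theorem fn_smul (d : Fin 6) (t : ZMod 5) (x : Fin 2 → ZMod 5) : fn d (t • x) = t * fn d x := by
  simp only [fn, Pi.smul_apply, smul_eq_mul]; ring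

theorem fn_dual_aux : ∀ d e : Fin 6, d ≠ e → ∃ v0 v1 w0 w1 : ZMod 5,
    uA d * v0 + uB d * v1 = 1 ∧ uA e * v0 + uB e * v1 = 0 ∧
    uA d * w0 + uB d * w1 = 0 ∧ uA e * w0 + uB e * w1 = 1 ∧ 
    uA d * v0 + uA e * w0 = 1 ∧ uB d * v0 + uB e * w0 = 0 ∧
    uA d * v1 + uA e * w1 = 0 ∧ uB d * v1 + uB e * w1 = 1 := by
  decide +kernel

/-- Dual basis for two different functionals. -/
theorem fn_dual (d e : Fin 6) (h : d ≠ e) : ∃ v w : Fin 2 → ZMod 5,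
    fn d v = 1 ∧ fn e v = 0 ∧ fn d w = 0 ∧ fn e w = 1 ∧
    ∀ x, x = fn d x • v + fn e x • w := by
  obtain ⟨v0, v1, w0, w1, h1, h2, h3, h4, h5, h6, h7, h8⟩ := fn_dual_aux d e h
  refine ⟨![v0, v1], ![w0, w1], ?_, ?_, ?_, ?_, ?_⟩
  · simpa [fn] using h1
  · simpa [fn] using h2
  · simpa [fn] using h3
  · simpa [fn] using h4
  · intro x
    ext i
    fin_cases i
    · simp [fn]; linear_combination (-x 0) * h5 - x 1 * h6
    · simp [fn]; linear_combination (-x 0) * h7 - x 1 * h8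

theorem four_of_five : ∀ T : Finset (ZMod 5), 4 ≤ T.card →
    ∃ a d : ZMod 5, d ≠ 0 ∧ a ∈ T ∧ a + d ∈ T ∧ a + 2 * d ∈ T ∧ a + 3 * d ∈ T := by
  decide +kernel

theorem three_of_four : ∀ T : Finset (ZMod 5), 3 ≤ T.card → 0 ∉ T →
    ∃ s : ZMod 5, ∀ b, b ≠ 0 → b ≠ s → b ∈ T := by
  decide +kernel

theorem wilson_step : ∀ s1 s2 s3 s4 : ZMod 5,
    (∃ b : ZMod 5, b ≠ 0 ∧ b ≠ s1 ∧ b ≠ s2 ∧ b ≠ s3 ∧ b ≠ s4) ∨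
    (∃ m : ZMod 5, m ≠ 0 ∧ m ≠ s1 ∧ 2 * m ≠ s2 ∧ 3 * m ≠ s3 ∧ 4 * m ≠ s4) := by
  decide +kernel

theorem not_ap {S : Finset (Fin 2 → ZMod 5)} (hS : ProgFree 5 2 4 S) (a d : Fin 2 → ZMod 5)
    (hd : d ≠ 0) (h0 : a ∈ S) (h1 : a + d ∈ S) (h2 : a + (2 : ZMod 5) • d ∈ S)
    (h3 : a + (3 : ZMod 5) • d ∈ S) : False := by
  apply hS
  refine ⟨a, d, hd, ?_⟩
  intro i hi
  interval_cases i
  · simpa using h0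
  · simpa using h1
  · exact_mod_cast h2
  · exact_mod_cast h3

def cnt (S : Finset (Fin 2 → ZMod 5)) (d : Fin 6) (c : ZMod 5) : ℕ :=
  (S.filter (fun x => fn d x = c)).card

theorem cnt_le {S : Finset (Fin 2 → ZMod 5)} (hS : ProgFree 5 2 4 S) (d : Fin 6) (c : ZMod 5) :
    cnt S d c ≤ 3 := by
  by_contra hc
  obtain ⟨e, he⟩ := exists_ne d
  obtain ⟨v, w, h1, h2, h3, h4, h5⟩ := fn_dual d e he.symm
  let T : Finset (ZMod 5) := Finset.univ.filter (fun t => c • v + t • w ∈ S)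
  have hsub : S.filter (fun x => fn d x = c) ⊆ T.image (fun t => c • v + t • w) := by
    intro x hx
    rw [Finset.mem_filter] at hx
    rw [Finset.mem_image]
    have := h5 x
    rw [hx.2] at this
    refine ⟨fn e x, ?_, this.symm⟩
    simp only [T, Finset.mem_filter, Finset.mem_univ, true_and]
    rw [← this]; exact hx.1
  have hT : 4 ≤ T.card := by
    have := (Finset.card_le_card hsub).trans Finset.card_image_le
    unfold cnt at hc
    omega
  obtain ⟨a, f, hf, m0, m1, m2, m3⟩ := four_of_five T hT
  simp only [T, Finset.mem_filter, Finset.mem_univ, true_and] at m0 m1 m2 m3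
  refine not_ap hS (c • v + a • w) (f • w) ?_ m0 ?_ ?_ ?_
  · intro h
    have := congrArg (fn e) h
    rw [fn_smul, h4] at this
    simp [fn] at this
    exact hf this
  · convert m1 using 1; module
  · convert m2 using 1; module
  · convert m3 using 1; module

theorem pair_aux : ∀ p q : ZMod 5, (∑ d : Fin 6, if uA d * p + uB d * q = 0 then 1 else 0)
    = if p = 0 ∧ q = 0 then 6 else 1 := by
  decide +kernel

theorem pair_count (x y : Fin 2 → ZMod 5) :
    (∑ d : Fin 6, if fn d x = fn d y then 1 else 0) = if x = y then 6 else 1 := by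
  have h := pair_aux (x 0 - y 0) (x 1 - y 1)
  have e1 : ∀ d, (uA d * (x 0 - y 0) + uB d * (x 1 - y 1) = 0) ↔ fn d x = fn d y := by
    intro d
    rw [← sub_eq_zero (a := fn d x)]
    have : uA d * (x 0 - y 0) + uB d * (x 1 - y 1) = fn d x - fn d y := by
      simp only [fn]; ring
    rw [this]
  have e2 : (x 0 - y 0 = 0 ∧ x 1 - y 1 = 0) ↔ x = y := by
    rw [sub_eq_zero, sub_eq_zero, funext_iff, Fin.forall_fin_two]
  simpa only [e1, e2] using h

theorem sum_cnt (S : Finset (Fin 2 → ZMod 5)) (d : Fin 6) : ∑ c, cnt S d c = S.card :=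
  (Finset.card_eq_sum_card_fiberwise (fun x _ => Finset.mem_univ (fn d x))).symm

theorem cnt_sq (S : Finset (Fin 2 → ZMod 5)) (d : Fin 6) :
    ∑ c, cnt S d c ^ 2 = ∑ x ∈ S, ∑ y ∈ S, if fn d x = fn d y then 1 else 0 := by
  have h1 : ∀ c, cnt S d c ^ 2 =
      ∑ x ∈ S, ∑ y ∈ S, if fn d x = c ∧ fn d y = c then 1 else 0 := by
    intro c
    simp only [cnt, Finset.card_filter, sq, Finset.sum_mul_sum, ite_and, mul_ite, mul_one,
      mul_zero]
    refine Finset.sum_congr rfl fun x _ => Finset.sum_congr rfl fun y _ => ?_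
    split_ifs <;> rfl
  simp only [h1]
  rw [Finset.sum_comm]
  refine Finset.sum_congr rfl fun x _ => ?_
  rw [Finset.sum_comm]
  refine Finset.sum_congr rfl fun y _ => ?_
  simp only [ite_and, Finset.sum_ite_eq, Finset.mem_univ, if_true]
  simp only [eq_comm]

theorem total_sq (S : Finset (Fin 2 → ZMod 5)) (hc : S.card = 12) :
    ∑ d, ∑ c, cnt S d c ^ 2 = 204 := by
  simp only [cnt_sq]
  rw [Finset.sum_comm]
  have : ∀ x ∈ S, (∑ d : Fin 6, ∑ y ∈ S, if fn d x = fn d y then 1 else 0) = 17 := by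
    intro x hx
    rw [Finset.sum_comm]
    simp only [pair_count]
    rw [← Finset.add_sum_erase S _ hx]
    rw [Finset.sum_congr rfl (g := fun _ => 1)]
    · simp [Finset.card_erase_of_mem hx, hc]
    · intro y hy
      rw [if_neg (Finset.ne_of_mem_erase hy).symm]
  rw [Finset.sum_congr rfl this]
  simp [hc]

theorem two_empty {S : Finset (Fin 2 → ZMod 5)} (hS : ProgFree 5 2 4 S) (hc : S.card = 12) :
    ∃ d e : Fin 6, d ≠ e ∧ (∃ c, cnt S d c = 0) ∧ (∃ c, cnt S e c = 0) := by
  have b36 : ∀ d, ∑ c, cnt S d c ^ 2 ≤ 36 := by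
    intro d
    calc ∑ c, cnt S d c ^ 2 ≤ ∑ c, 3 * cnt S d c := by
          refine Finset.sum_le_sum fun c _ => ?_
          have := cnt_le hS d c
          nlinarith
      _ = 36 := by
          rw [← Finset.mul_sum, sum_cnt, hc]
          norm_num
  have b33 : ∀ d, (∀ c, cnt S d c ≠ 0) → ∑ c, cnt S d c ^ 2 ≤ 33 := by
    intro d hd
    have : ∑ c, (cnt S d c ^ 2 + 3) ≤ ∑ c, 4 * cnt S d c := by
      refine Finset.sum_le_sum fun c _ => ?_
      have h3 := cnt_le hS d c
      have h1 := hd c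
      generalize cnt S d c = n at *
      interval_cases n <;> simp_all
    rw [← Finset.mul_sum, sum_cnt, hc, Finset.sum_add_distrib] at this
    simp at this
    omega
  have ht := total_sq S hc
  by_contra hno
  have hno' : ∀ d e : Fin 6, d ≠ e → (∃ c, cnt S d c = 0) → ∀ c, cnt S e c ≠ 0 := by
    intro d e hde h1 c h2
    exact hno ⟨d, e, hde, h1, c, h2⟩
  by_cases hex : ∃ d, ∃ c, cnt S d c = 0
  · obtain ⟨d, hd⟩ := hex
    rw [← Finset.add_sum_erase _ _ (Finset.mem_univ d)] at ht
    have h1 := b36 d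
    have h2 : ∑ e ∈ Finset.univ.erase d, ∑ c, cnt S e c ^ 2 ≤ 5 * 33 := by
      refine (Finset.sum_le_card_nsmul _ _ 33 fun e he => ?_).trans (by simp)
      exact b33 e (hno' d e (Finset.ne_of_mem_erase he).symm hd)
    omega
  · have h2 : ∑ e, ∑ c, cnt S e c ^ 2 ≤ 6 * 33 := by
      refine (Finset.sum_le_card_nsmul _ _ 33 fun e he => ?_).trans (by simp)
      exact b33 e (fun c h => hex ⟨e, c, h⟩)
    omega

theorem no_twelve {S : Finset (Fin 2 → ZMod 5)} (hS : ProgFree 5 2 4 S) (hc : S.card = 12) :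
    False := by
  obtain ⟨d, e, hde, ⟨c, hdc⟩, ⟨c', hec⟩⟩ := two_empty hS hc
  obtain ⟨v, w, h1, h2, h3, h4, h5⟩ := fn_dual d e hde
  let P : ZMod 5 → ZMod 5 → (Fin 2 → ZMod 5) := fun a b => (c + a) • v + (c' + b) • w
  have hPe : ∀ a b, fn e (P a b) = c' + b := by
    intro a b
    simp only [P, fn_add, fn_smul, h2, h4]; ring
  have row3 : ∀ a, a ≠ 0 → 3 ≤ cnt S d (c + a) := by
    intro a ha
    have hs := sum_cnt S d
    have hne : c + a ≠ c := by simpa using ha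
    rw [hc, ← Finset.add_sum_erase _ _ (Finset.mem_univ c), hdc,
      ← Finset.add_sum_erase _ _ (Finset.mem_erase.2 ⟨hne, Finset.mem_univ (c + a)⟩)] at hs
    have hcard : ((Finset.univ.erase c).erase (c + a)).card = 3 := by
      rw [Finset.card_erase_of_mem (Finset.mem_erase.2 ⟨hne, Finset.mem_univ _⟩),
        Finset.card_erase_of_mem (Finset.mem_univ _)]
      simp [ZMod.card]
    have := Finset.sum_le_card_nsmul ((Finset.univ.erase c).erase (c + a)) (fun x => cnt S d x) 3
      (fun x _ => cnt_le hS d x)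
    rw [hcard] at this
    simp only [smul_eq_mul] at this
    omega
  have key : ∀ a, a ≠ 0 → ∃ s : ZMod 5, ∀ b, b ≠ 0 → b ≠ s → P a b ∈ S := by
    intro a ha
    let T : Finset (ZMod 5) := Finset.univ.filter (fun b => P a b ∈ S)
    have hsub : S.filter (fun x => fn d x = c + a) ⊆ T.image (P a) := by
      intro x hx
      rw [Finset.mem_filter] at hx
      have hx' : P a (fn e x - c') = x := by
        conv_rhs => rw [h5 x, hx.2]
        simp [P]
      rw [Finset.mem_image]
      refine ⟨fn e x - c', ?_, hx'⟩
      simp only [T, Finset.mem_filter, Finset.mem_univ, true_and, hx', hx.1]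
    have hT : 3 ≤ T.card :=
      (row3 a ha).trans ((Finset.card_le_card hsub).trans Finset.card_image_le)
    have h0 : (0 : ZMod 5) ∉ T := by
      intro h
      simp only [T, Finset.mem_filter, Finset.mem_univ, true_and] at h
      have hm := Finset.card_eq_zero.1 hec
      have : P a 0 ∈ S.filter (fun x => fn e x = c') :=
        Finset.mem_filter.2 ⟨h, by rw [hPe]; simp⟩
      rw [hm] at this
      simp at this
    obtain ⟨s, hs⟩ := three_of_four T hT h0
    refine ⟨s, fun b hb hbs => ?_⟩
    have := hs b hb hbs
    simpa only [T, Finset.mem_filter, Finset.mem_univ, true_and] using this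
  obtain ⟨s1, k1⟩ := key 1 (by decide)
  obtain ⟨s2, k2⟩ := key 2 (by decide)
  obtain ⟨s3, k3⟩ := key 3 (by decide)
  obtain ⟨s4, k4⟩ := key 4 (by decide)
  rcases wilson_step s1 s2 s3 s4 with ⟨b, hb, n1, n2, n3, n4⟩ | ⟨m, hm, n1, n2, n3, n4⟩
  · refine not_ap hS (P 1 b) v ?_ (k1 b hb n1) ?_ ?_ ?_
    · rintro rfl
      simp [fn] at h1
      exact absurd h1 (by decide)
    · convert k2 b hb n2 using 1; simp only [P]; module
    · convert k3 b hb n3 using 1; simp only [P]; module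
    · convert k4 b hb n4 using 1; simp only [P]; module
  · have z : ∀ m : ZMod 5, m ≠ 0 → 2 * m ≠ 0 ∧ 3 * m ≠ 0 ∧ 4 * m ≠ 0 := by decide
    obtain ⟨z2, z3, z4⟩ := z m hm
    refine not_ap hS (P 1 m) (v + m • w) ?_ (k1 m hm n1) ?_ ?_ ?_
    · intro h
      have := congrArg (fn d) h
      rw [fn_add, fn_smul, h1, h3] at this
      simp [fn] at this
      exact absurd this (by decide)
    · convert k2 _ z2 n2 using 1; simp only [P]; module
    · convert k3 _ z3 n3 using 1; simp only [P]; module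
    · convert k4 _ z4 n4 using 1; simp only [P]; module

theorem ProgFree.mono {S T : Finset (Fin 2 → ZMod 5)} (hS : ProgFree 5 2 4 S) (h : T ⊆ S) :
    ProgFree 5 2 4 T := by
  rintro ⟨a, d, hd, had⟩
  exact hS ⟨a, d, hd, fun i hi => h (had i hi)⟩

def exSet : Finset (Fin 2 → ZMod 5) := {![0, 0], ![0, 2], ![1, 1], ![1, 2], ![1, 4], ![3, 0], ![3, 1], ![3, 4], ![4, 0], ![4, 1], ![4, 2]}

theorem stmt_15 :
    (∃ S : Finset (Fin 2 → ZMod 5), ProgFree 5 2 4 S ∧ S.card = 11) ∧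
    (∀ S : Finset (Fin 2 → ZMod 5), ProgFree 5 2 4 S → S.card ≤ 11) := by
  constructor
  · refine ⟨exSet, ?_, by decide +kernel⟩
    unfold ProgFree
    decide +kernel
  · intro S hS
    by_contra h
    obtain ⟨T, hT, hc⟩ := Finset.exists_subset_card_eq (show 12 ≤ S.card by omega)
    exact no_twelve (hS.mono hT) hc
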